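/- Let A ≥ 1, let (X,d) be an A-uniform metric space with d(x) > 0 for every x ∈ X, let k be its quasihyperbolic metric, and let p ∈ X. If {x_i} is a sequence in X such that (x_i|x_j)^k_p → ∞ as i, j → ∞ and {x_i} is unbounded with respect to d (i.e. sup_i d(x_i, p) = ∞), then d(x_i, q) → ∞ as i → ∞ for every q ∈ X. -/

import Mathlib

open Metric Filter Set

noncomputable section

universe u v

/-- Gromov product of `x` and `y` with respect to base point `w`,
for a real-valued distance kernel `ρ`. -/
def gromovProd {X : Type u} (ρ : X → X → ℝ) (w x y : X) : ℝ :=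
  (ρ x w + ρ y w - ρ x y) / 2

/-- `(X, ρ)` is δ-hyperbolic. -/
def IsDeltaHyp {X : Type u} (ρ : X → X → ℝ) (δ : ℝ) : Prop :=
  ∀ x y z w : X, gromovProd ρ w x y ≥ min (gromovProd ρ w x z) (gromovProd ρ w z y) - δ

/-- `f` is a (λ,μ)-rough similarity. -/
def RoughSimilarity {X : Type u} {Y : Type v} [MetricSpace X] [MetricSpace Y]
    (lam mu : ℝ) (f : X → Y) : Prop :=
  (∀ y : Y, ∃ x : X, dist y (f x) ≤ mu) ∧
  (∀ x x' : X, lam * dist x x' - mu ≤ dist (f x) (f x') ∧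
    dist (f x) (f x') ≤ lam * dist x x' + mu)

/-- The distance from `x ∈ X` to the metric boundary `∂X = X̄ \ X`. -/
def distToBdry (X : Type u) [MetricSpace X] (x : X) : ℝ :=
  Metric.infDist (x : UniformSpace.Completion X)
    (Set.range ((↑) : X → UniformSpace.Completion X))ᶜ

/-- `X` is noncomplete, i.e. `∂X = X̄ \ X ≠ ∅`. -/
def IsNoncomplete (X : Type u) [MetricSpace X] : Prop :=
  ((Set.range ((↑) : X → UniformSpace.Completion X))ᶜ).Nonempty

/-- Ibragimov's hyperbolization metric. -/
def hMetric (X : Type u) [MetricSpace X] (x y : X) : ℝ :=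
  2 * Real.log ((dist x y + max (distToBdry X x) (distToBdry X y)) /
    Real.sqrt (distToBdry X x * distToBdry X y))

/-- The j̃-metric. -/
def jtMetric (X : Type u) [MetricSpace X] (x y : X) : ℝ :=
  (1 / 2) * Real.log ((1 + dist x y / distToBdry X x) * (1 + dist x y / distToBdry X y))

/-- The quasihyperbolic metric. -/
def quasihyperbolic (X : Type u) [MetricSpace X] (x y : X) : ℝ :=
  sInf {r : ℝ | ∃ L : ℝ, 0 ≤ L ∧ ∃ γ : ℝ → X,
    LipschitzOnWith 1 γ (Set.Icc 0 L) ∧ γ 0 = x ∧ γ L = y ∧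
    r = ∫ t in (0:ℝ)..L, (distToBdry X (γ t))⁻¹}

/-- `X` is an `A`-uniform metric space. -/
def IsUniformMS (X : Type u) [MetricSpace X] (A : ℝ) : Prop :=
  ∀ x y : X, ∃ L : ℝ, 0 ≤ L ∧ ∃ γ : ℝ → X,
    LipschitzOnWith 1 γ (Set.Icc 0 L) ∧ γ 0 = x ∧ γ L = y ∧
    L ≤ A * dist x y ∧ ∀ t ∈ Set.Icc (0:ℝ) L, min t (L - t) ≤ A * distToBdry X (γ t)

/-- `X` is unbounded. -/
def IsUnbounded (X : Type u) [MetricSpace X] : Prop :=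
  ¬ Bornology.IsBounded (Set.univ : Set X)

section Quasihyperbolic

variable {X : Type u} [MetricSpace X]

theorem distToBdry_le_add_dist (x y : X) : distToBdry X x ≤ distToBdry X y + dist x y := by
  rw [← UniformSpace.Completion.dist_eq x y]
  exact infDist_le_infDist_add_dist

theorem continuous_distToBdry : Continuous (distToBdry X) :=
  (continuous_infDist_pt _).comp (UniformSpace.Completion.continuous_coe X)

theorem continuousOn_inv_distToBdry (hd : ∀ x : X, 0 < distToBdry X x) {γ : ℝ → X} {s : Set ℝ}
    (hγ : ContinuousOn γ s) : ContinuousOn (fun t => (distToBdry X (γ t))⁻¹) s :=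
  (continuous_distToBdry.comp_continuousOn hγ).inv₀ fun t _ => (hd (γ t)).ne'

theorem quasihyperbolic_le_integral (hd : ∀ x : X, 0 < distToBdry X x) {L : ℝ} (hL : 0 ≤ L)
    {γ : ℝ → X} (hγ : LipschitzOnWith 1 γ (Icc 0 L)) :
    quasihyperbolic X (γ 0) (γ L) ≤ ∫ t in (0 : ℝ)..L, (distToBdry X (γ t))⁻¹ := by
  refine csInf_le ⟨0, ?_⟩ ⟨L, hL, γ, hγ, rfl, rfl, rfl⟩
  rintro r ⟨L, hL, γ, -, -, -, rfl⟩
  exact intervalIntegral.integral_nonneg hL fun t _ => (inv_pos.2 (hd _)).le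

theorem quasihyperbolic_le_integral_Icc (hd : ∀ x : X, 0 < distToBdry X x) {a b : ℝ} (hab : a ≤ b)
    {γ : ℝ → X} (hγ : LipschitzOnWith 1 γ (Icc a b)) :
    quasihyperbolic X (γ a) (γ b) ≤ ∫ t in a..b, (distToBdry X (γ t))⁻¹ := by
  have h := quasihyperbolic_le_integral hd (sub_nonneg.2 hab) (γ := fun t => γ (t + a)) (by
    refine LipschitzOnWith.of_dist_le_mul fun s hs t ht => ?_
    have := hγ.dist_le_mul (s + a) ⟨by linarith [hs.1], by linarith [hs.2]⟩ (t + a)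
      ⟨by linarith [ht.1], by linarith [ht.2]⟩
    rwa [dist_add_right] at this)
  have h' := intervalIntegral.integral_comp_add_right (a := 0) (b := b - a)
    (fun t => (distToBdry X (γ t))⁻¹) a
  rw [h'] at h
  simpa using h

theorem lipschitzOnWith_comp_neg {γ : ℝ → X} {a b : ℝ} (hγ : LipschitzOnWith 1 γ (Icc a b)) :
    LipschitzOnWith 1 (fun t => γ (-t)) (Icc (-b) (-a)) := by
  refine LipschitzOnWith.of_dist_le_mul fun s hs t ht => ?_
  have := hγ.dist_le_mul (-s) ⟨by linarith [hs.2], by linarith [hs.1]⟩ (-t)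
    ⟨by linarith [ht.2], by linarith [ht.1]⟩
  rwa [dist_neg_neg] at this

theorem quasihyperbolic_le_integral_Icc_reverse (hd : ∀ x : X, 0 < distToBdry X x) {a b : ℝ}
    (hab : a ≤ b) {γ : ℝ → X} (hγ : LipschitzOnWith 1 γ (Icc a b)) :
    quasihyperbolic X (γ b) (γ a) ≤ ∫ t in a..b, (distToBdry X (γ t))⁻¹ := by
  have h := quasihyperbolic_le_integral_Icc hd (neg_le_neg hab) (lipschitzOnWith_comp_neg hγ)
  have h' := intervalIntegral.integral_comp_neg (a := -b) (b := -a)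
    (fun t => (distToBdry X (γ t))⁻¹)
  rw [h'] at h
  simpa using h

theorem IsUniformMS.exists_integral_lt {A : ℝ} (hXA : IsUniformMS X A) {x y : X} {r : ℝ}
    (hr : quasihyperbolic X x y < r) :
    ∃ L : ℝ, 0 ≤ L ∧ ∃ γ : ℝ → X, LipschitzOnWith 1 γ (Icc 0 L) ∧ γ 0 = x ∧ γ L = y ∧
      ∫ t in (0 : ℝ)..L, (distToBdry X (γ t))⁻¹ < r := by
  obtain ⟨_, ⟨L, hL, γ, hγ, h0, h1, rfl⟩, h⟩ := exists_lt_of_csInf_lt (by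
    obtain ⟨L, hL, γ, hγ, h0, h1, -⟩ := hXA x y
    exact ⟨_, L, hL, γ, hγ, h0, h1, rfl⟩) hr
  exact ⟨L, hL, γ, hγ, h0, h1, h⟩

theorem lipschitzOnWith_concat {γ₁ γ₂ : ℝ → X} {L₁ L₂ : ℝ}
    (h₁ : LipschitzOnWith 1 γ₁ (Icc 0 L₁)) (h₂ : LipschitzOnWith 1 γ₂ (Icc 0 L₂))
    (h : γ₁ L₁ = γ₂ 0) :
    LipschitzOnWith 1 (fun t => if t ≤ L₁ then γ₁ t else γ₂ (t - L₁)) (Icc 0 (L₁ + L₂)) := by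
  refine LipschitzOnWith.of_dist_le' (K := 1) ?_ |> fun h => by simpa using h
  have key : ∀ s ∈ Icc 0 (L₁ + L₂), ∀ t ∈ Icc 0 (L₁ + L₂), s ≤ t →
      dist (if s ≤ L₁ then γ₁ s else γ₂ (s - L₁)) (if t ≤ L₁ then γ₁ t else γ₂ (t - L₁))
        ≤ t - s := by
    intro s hs t ht hst
    have hd₁ : ∀ u v, 0 ≤ u → u ≤ v → v ≤ L₁ → dist (γ₁ u) (γ₁ v) ≤ v - u := by
      intro u v hu huv hv
      have := h₁.dist_le_mul u ⟨hu, huv.trans hv⟩ v ⟨hu.trans huv, hv⟩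
      rwa [dist_comm u v, Real.dist_eq, abs_of_nonneg (sub_nonneg.2 huv), NNReal.coe_one,
        one_mul] at this
    have hd₂ : ∀ u v, 0 ≤ u → u ≤ v → v ≤ L₂ → dist (γ₂ u) (γ₂ v) ≤ v - u := by
      intro u v hu huv hv
      have := h₂.dist_le_mul u ⟨hu, huv.trans hv⟩ v ⟨hu.trans huv, hv⟩
      rwa [dist_comm u v, Real.dist_eq, abs_of_nonneg (sub_nonneg.2 huv), NNReal.coe_one,
        one_mul] at this
    have hs0 := hs.1
    have ht1 := ht.2
    split_ifs with h1 h2 h2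
    · exact hd₁ s t hs0 hst h2
    · have e1 := hd₁ s L₁ hs0 h1 le_rfl
      have e2 := hd₂ 0 (t - L₁) le_rfl (by linarith) (by linarith)
      rw [h] at e1
      linarith [dist_triangle (γ₁ s) (γ₂ 0) (γ₂ (t - L₁))]
    · linarith
    · linarith [hd₂ (s - L₁) (t - L₁) (by linarith) (by linarith) (by linarith)]
  intro s hs t ht
  rw [one_mul, Real.dist_eq]
  rcases le_total s t with hst | hst
  · rw [abs_sub_comm]
    exact (key s hs t ht hst).trans (le_abs_self _)
  · rw [dist_comm]
    exact (key t ht s hs hst).trans (le_abs_self _)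

theorem IsUniformMS.quasihyperbolic_triangle {A : ℝ} (hXA : IsUniformMS X A)
    (hd : ∀ x : X, 0 < distToBdry X x) (x y z : X) :
    quasihyperbolic X x z ≤ quasihyperbolic X x y + quasihyperbolic X y z := by
  refine le_of_forall_pos_le_add fun ε hε => ?_
  obtain ⟨L₁, hL₁, γ₁, hγ₁, rfl, rfl, h₁⟩ := hXA.exists_integral_lt
    (lt_add_of_pos_right (quasihyperbolic X x y) (half_pos hε))
  obtain ⟨L₂, hL₂, γ₂, hγ₂, h0, rfl, h₂⟩ := hXA.exists_integral_lt
    (lt_add_of_pos_right (quasihyperbolic X (γ₁ L₁) z) (half_pos hε))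
  have hγ := lipschitzOnWith_concat hγ₁ hγ₂ h0.symm
  set γ : ℝ → X := fun t => if t ≤ L₁ then γ₁ t else γ₂ (t - L₁) with hγdef
  have hL : L₁ ≤ L₁ + L₂ := by linarith
  have e₁ : EqOn (fun t => (distToBdry X (γ t))⁻¹) (fun t => (distToBdry X (γ₁ t))⁻¹)
      (uIcc 0 L₁) := by
    intro t ht
    rw [uIcc_of_le hL₁] at ht
    simp [hγdef, ht.2]
  have e₂ : EqOn (fun t => (distToBdry X (γ t))⁻¹) (fun t => (distToBdry X (γ₂ (t - L₁)))⁻¹)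
      (uIcc L₁ (L₁ + L₂)) := by
    intro t ht
    rw [uIcc_of_le hL] at ht
    rcases ht.1.eq_or_lt with rfl | hlt
    · simp [hγdef, h0]
    · simp [hγdef, hlt.not_ge]
  have hcont := continuousOn_inv_distToBdry hd hγ.continuousOn
  have hint := intervalIntegral.integral_add_adjacent_intervals
    ((hcont.mono (Icc_subset_Icc_right hL)).intervalIntegrable_of_Icc (μ := MeasureTheory.volume)
      hL₁)
    ((hcont.mono (Icc_subset_Icc_left hL₁)).intervalIntegrable_of_Icc hL)
  have hk := quasihyperbolic_le_integral hd (hL₁.trans hL) hγ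
  have hγ0 : γ 0 = γ₁ 0 := by simp [hγdef, hL₁]
  have hγL : γ (L₁ + L₂) = γ₂ L₂ := by
    rcases hL₂.eq_or_lt with rfl | hlt
    · simp [hγdef, h0]
    · simp [hγdef, hlt]
  have hc := intervalIntegral.integral_comp_sub_right (a := L₁) (b := L₁ + L₂)
    (fun t => (distToBdry X (γ₂ t))⁻¹) L₁
  rw [sub_self, add_sub_cancel_left] at hc
  rw [hγ0, hγL, ← hint, intervalIntegral.integral_congr e₁, intervalIntegral.integral_congr e₂,
    hc] at hk
  linarith

theorem IsUniformMS.quasihyperbolic_le_log {A : ℝ} (hA : 1 ≤ A) (hXA : IsUniformMS X A)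
    (hd : ∀ x : X, 0 < distToBdry X x) {x y : X} {m : ℝ} (hm : 0 < m)
    (hx : m ≤ distToBdry X x) (hy : m ≤ distToBdry X y) :
    quasihyperbolic X x y ≤ 2 * (2 * A + 1) * Real.log (1 + A * dist x y / m) := by
  obtain ⟨L, hL, γ, hγ, rfl, rfl, hLA, hu⟩ := hXA x y
  refine (quasihyperbolic_le_integral hd hL hγ).trans ?_
  have hc₁ : ContinuousOn (fun t : ℝ => (m + t)⁻¹) (Icc 0 L) :=
    (by fun_prop : ContinuousOn (fun t : ℝ => m + t) (Icc 0 L)).inv₀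
      fun t ht => by linarith [ht.1] |> fun h : 0 < m + t => h.ne'
  have hc₂ : ContinuousOn (fun t : ℝ => (m + L - t)⁻¹) (Icc 0 L) :=
    (by fun_prop : ContinuousOn (fun t : ℝ => m + L - t) (Icc 0 L)).inv₀
      fun t ht => by linarith [ht.2] |> fun h : 0 < m + L - t => h.ne'
  have hle : ∀ t ∈ Icc 0 L,
      (distToBdry X (γ t))⁻¹ ≤ (2 * A + 1) * ((m + t)⁻¹ + (m + L - t)⁻¹) := by
    intro t ht
    have d1 : m ≤ distToBdry X (γ t) + t := by
      have := hγ.dist_le_mul 0 ⟨le_rfl, hL⟩ t ht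
      rw [Real.dist_eq, zero_sub, abs_neg, abs_of_nonneg ht.1, NNReal.coe_one, one_mul] at this
      linarith [distToBdry_le_add_dist (γ 0) (γ t)]
    have d2 : m ≤ distToBdry X (γ t) + (L - t) := by
      have := hγ.dist_le_mul L ⟨hL, le_rfl⟩ t ht
      rw [Real.dist_eq, abs_of_nonneg (sub_nonneg.2 ht.2), NNReal.coe_one, one_mul] at this
      linarith [distToBdry_le_add_dist (γ L) (γ t)]
    have p1 : 0 < m + t := by linarith [ht.1]
    have p2 : 0 < m + L - t := by linarith [ht.2]
    have hut := hu t ht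
    have bound : ∀ w, 0 < w → w ≤ (2 * A + 1) * distToBdry X (γ t) →
        (distToBdry X (γ t))⁻¹ ≤ (2 * A + 1) * w⁻¹ := by
      intro w hw h
      rw [inv_le_iff_one_le_mul₀ (hd _), mul_right_comm, ← div_eq_mul_inv, le_div_iff₀ hw, one_mul]
      exact h
    have q1 := inv_pos.2 p1
    have q2 := inv_pos.2 p2
    rcases le_total t (L - t) with h | h
    · rw [min_eq_left h] at hut
      refine (bound (m + t) p1 (by linarith)).trans ?_
      gcongr
      linarith
    · rw [min_eq_right h] at hut
      refine (bound (m + L - t) p2 (by linarith)).trans ?_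
      gcongr
      linarith
  have i₁ : ∫ t in (0 : ℝ)..L, (m + t)⁻¹ = Real.log ((m + L) / m) := by
    rw [intervalIntegral.integral_comp_add_left (fun t : ℝ => t⁻¹),
      integral_inv_of_pos (by linarith) (by linarith), add_zero]
  have i₂ : ∫ t in (0 : ℝ)..L, (m + L - t)⁻¹ = Real.log ((m + L) / m) := by
    rw [intervalIntegral.integral_comp_sub_left (fun t : ℝ => t⁻¹),
      integral_inv_of_pos (by linarith) (by linarith), add_sub_cancel_right, sub_zero]
  have I₁ := hc₁.intervalIntegrable_of_Icc (μ := MeasureTheory.volume) hL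
  have I₂ := hc₂.intervalIntegrable_of_Icc (μ := MeasureTheory.volume) hL
  have hmono := intervalIntegral.integral_mono_on hL
    ((continuousOn_inv_distToBdry hd hγ.continuousOn).intervalIntegrable_of_Icc hL)
    ((I₁.add I₂).const_mul (2 * A + 1)) hle
  rw [intervalIntegral.integral_const_mul, intervalIntegral.integral_add I₁ I₂, i₁, i₂] at hmono
  have hlog : Real.log ((m + L) / m) ≤ Real.log (1 + A * dist (γ 0) (γ L) / m) := by
    refine Real.log_le_log (by positivity) ?_
    rw [add_div, div_self hm.ne']
    gcongr
  have := mul_le_mul_of_nonneg_left hlog (by linarith : 0 ≤ 2 * (2 * A + 1))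
  linarith

theorem exists_first_hitting {f : ℝ → ℝ} {a b c : ℝ} (hab : a ≤ b) (hf : ContinuousOn f (Icc a b))
    (ha : f a ≤ c) (hb : c ≤ f b) :
    ∃ T ∈ Icc a b, f T = c ∧ ∀ t ∈ Icc a T, f t ≤ c := by
  have hcpt : IsCompact (Icc a b ∩ f ⁻¹' {c}) :=
    isCompact_Icc.of_isClosed_subset (hf.preimage_isClosed_of_isClosed isClosed_Icc
      isClosed_singleton) inter_subset_left
  obtain ⟨t₀, ht₀, hft₀⟩ := intermediate_value_Icc hab hf ⟨ha, hb⟩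
  obtain ⟨T, ⟨hT, hfT⟩, hmin⟩ := hcpt.exists_isLeast ⟨t₀, ht₀, hft₀⟩
  refine ⟨T, hT, hfT, fun t ht => ?_⟩
  by_contra! hlt
  have hsub : Icc a t ⊆ Icc a b := Icc_subset_Icc_right (ht.2.trans hT.2)
  obtain ⟨s, hs, hfs⟩ := intermediate_value_Icc ht.1 (hf.mono hsub) ⟨ha, hlt.le⟩
  have hTs : T ≤ s := hmin ⟨hsub hs, hfs⟩
  have : t = T := le_antisymm ht.2 (hTs.trans hs.2)
  rw [this, show f T = c from hfT] at hlt
  exact lt_irrefl _ hlt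

/-- A curve whose subcurves of comparable height have diameter bounded by a multiple of their
height, and whose height is largest at the right endpoint, has endpoints at distance bounded by a
multiple of that height. -/
theorem dist_le_of_height_le_right {γ : ℝ → X} {f : ℝ → ℝ} {a b C : ℝ} (hC : 0 ≤ C)
    (hf : ContinuousOn f (Icc a b)) (hpos : ∀ t, 0 < f t)
    (H : ∀ u v M, a ≤ u → u ≤ v → v ≤ b → (∀ t ∈ Icc u v, f t ≤ M) → M ≤ 2 * f u → M ≤ 2 * f v →
      dist (γ u) (γ v) ≤ C * M)
    (hab : a ≤ b) (hmax : ∀ t ∈ Icc a b, f t ≤ f b) :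
    dist (γ a) (γ b) ≤ 2 * C * f b := by
  obtain ⟨n, hn⟩ : ∃ n : ℕ, f b ≤ 2 ^ n * f a := by
    obtain ⟨n, hn⟩ := pow_unbounded_of_one_lt (f b / f a) (one_lt_two (α := ℝ))
    exact ⟨n, ((div_lt_iff₀ (hpos a)).1 hn).le⟩
  induction n generalizing b with
  | zero =>
    have := H a b (f b) le_rfl hab le_rfl hmax (by linarith [hpos a]) (by linarith [hpos b])
    nlinarith [mul_nonneg hC (hpos b).le]
  | succ n ih =>
    rcases le_total (f b) (2 * f a) with h | h
    · have := H a b (f b) le_rfl hab le_rfl hmax h (by linarith [hpos b])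
      nlinarith [mul_nonneg hC (hpos b).le]
    · obtain ⟨T, hT, hfT, hle⟩ := exists_first_hitting (c := f b / 2) hab hf (by linarith)
        (by linarith [hpos b])
      have h₁ := ih (hf.mono (Icc_subset_Icc_right hT.2))
        (fun u v M hu huv hv => H u v M hu huv (hv.trans hT.2)) hT.1 (by rwa [hfT]) (by
          rw [hfT]
          rw [pow_succ] at hn
          linarith)
      have h₂ := H T b (f b) hT.1 hT.2 le_rfl (fun t ht => hmax t ⟨hT.1.trans ht.1, ht.2⟩)
        (by linarith) (by linarith [hpos b])
      rw [hfT] at h₁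
      linarith [dist_triangle (γ a) (γ T) (γ b)]

theorem exists_bound_of_le_log {A B : ℝ} (hA : 0 < A) (hB : 0 < B) :
    ∃ C : ℝ, 0 < C ∧ ∀ u : ℝ, 0 ≤ u → u ≤ B * Real.log (1 + A * u) + 1 → u ≤ C := by
  refine ⟨max 1 (2 * (1 + B * Real.log (2 * A * B) + 1 / (2 * A))), by positivity, fun u hu h => ?_⟩
  refine le_max_of_le_right ?_
  have hlog := Real.log_le_sub_one_of_pos (x := (1 + A * u) / (2 * A * B)) (by positivity)
  rw [Real.log_div (by positivity) (by positivity)] at hlog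
  have := mul_le_mul_of_nonneg_left hlog hB.le
  have e : B * ((1 + A * u) / (2 * A * B) - 1) = 1 / (2 * A) + u / 2 - B := by
    field_simp
  rw [e] at this
  linarith

/-- Along an almost minimizing curve for the quasihyperbolic metric, some point reaches a height
comparable to the distance between the endpoints. -/
theorem IsUniformMS.exists_height_bound {A : ℝ} (hA : 1 ≤ A) (hXA : IsUniformMS X A)
    (hd : ∀ x : X, 0 < distToBdry X x) :
    ∃ C : ℝ, 0 < C ∧ ∀ (T : ℝ) (γ : ℝ → X), 0 ≤ T → LipschitzOnWith 1 γ (Icc 0 T) →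
      (∀ u v, 0 ≤ u → u ≤ v → v ≤ T →
        ∫ t in u..v, (distToBdry X (γ t))⁻¹ ≤ quasihyperbolic X (γ u) (γ v) + 1) →
      ∃ τ ∈ Icc 0 T, dist (γ 0) (γ T) ≤ C * distToBdry X (γ τ) := by
  obtain ⟨C, hC, hlog⟩ := exists_bound_of_le_log (A := 2 * A) (B := 2 * (2 * A + 1))
    (by linarith) (by linarith)
  refine ⟨4 * C, by linarith, fun T γ hT hγ hmin => ?_⟩
  have hf : ContinuousOn (fun t => distToBdry X (γ t)) (Icc 0 T) :=
    continuous_distToBdry.comp_continuousOn hγ.continuousOn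
  obtain ⟨τ, hτ, hmax⟩ := isCompact_Icc.exists_isMaxOn (nonempty_Icc.2 hT) hf
  replace hmax : ∀ t ∈ Icc 0 T, distToBdry X (γ t) ≤ distToBdry X (γ τ) := hmax
  refine ⟨τ, hτ, ?_⟩
  have H : ∀ u v M, 0 ≤ u → u ≤ v → v ≤ T → (∀ t ∈ Icc u v, distToBdry X (γ t) ≤ M) →
      M ≤ 2 * distToBdry X (γ u) → M ≤ 2 * distToBdry X (γ v) → dist (γ u) (γ v) ≤ C * M := by
    intro u v M hu huv hv hM hMu hMv
    have hM0 : 0 < M := (hd _).trans_le (hM u ⟨le_rfl, huv⟩)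
    have hk := hXA.quasihyperbolic_le_log hA hd (x := γ u) (y := γ v) (half_pos hM0)
      (by linarith) (by linarith)
    have hsub : Icc u v ⊆ Icc 0 T := Icc_subset_Icc hu hv
    have hlow : (v - u) * M⁻¹ ≤ ∫ t in u..v, (distToBdry X (γ t))⁻¹ := by
      have := intervalIntegral.integral_mono_on huv (f := fun _ => M⁻¹)
        (by simp)
        ((continuousOn_inv_distToBdry hd (hγ.continuousOn.mono hsub)).intervalIntegrable_of_Icc
          huv) (μ := MeasureTheory.volume) fun t ht => inv_anti₀ (hd _) (hM t ht)
      simpa using this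
    have hdist : dist (γ u) (γ v) ≤ v - u := by
      have := hγ.dist_le_mul u (hsub ⟨le_rfl, huv⟩) v (hsub ⟨huv, le_rfl⟩)
      rwa [dist_comm u v, Real.dist_eq, abs_of_nonneg (sub_nonneg.2 huv), NNReal.coe_one,
        one_mul] at this
    have hdist' := mul_le_mul_of_nonneg_right hdist (inv_pos.2 hM0).le
    rw [← div_le_iff₀ hM0]
    refine hlog _ (by positivity) ?_
    rw [show 2 * A * (dist (γ u) (γ v) / M) = A * dist (γ u) (γ v) / (M / 2) by field_simp,
      div_eq_mul_inv]
    linarith [hmin u v hu huv hv]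
  have h₁ := dist_le_of_height_le_right hC.le (hf.mono (Icc_subset_Icc_right hτ.2))
    (fun t => hd _) (fun u v M hu huv hv => H u v M hu huv (hv.trans hτ.2)) hτ.1
    (fun t ht => hmax t ⟨ht.1, ht.2.trans hτ.2⟩)
  have h₂ := dist_le_of_height_le_right (γ := fun t => γ (-t))
    (f := fun t => distToBdry X (γ (-t))) (a := -T) (b := -τ) hC.le
    (hf.comp continuous_neg.continuousOn fun t ht =>
      ⟨by linarith [ht.2, hτ.1], by linarith [ht.1]⟩)
    (fun t => hd _) (fun u v M hu huv hv hM hMu hMv => by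
      rw [dist_comm]
      refine H (-v) (-u) M (by linarith [hτ.1]) (by linarith) (by linarith) (fun t ht => ?_) hMv hMu
      simpa using hM (-t) ⟨by linarith [ht.2], by linarith [ht.1]⟩)
    (neg_le_neg hτ.2)
    (fun t ht => by
      simpa using hmax (-t) ⟨by linarith [ht.2, hτ.1], by linarith [ht.1]⟩)
  simp only [neg_neg] at h₂
  rw [dist_comm] at h₂
  linarith [dist_triangle (γ 0) (γ τ) (γ T)]

/-- For a bounded point and a point a bit further away, the Gromov product in the
quasihyperbolic metric is bounded. -/
theorem IsUniformMS.exists_gromovProd_le {A : ℝ} (hA : 1 ≤ A) (hXA : IsUniformMS X A)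
    (hd : ∀ x : X, 0 < distToBdry X x) (p : X) (R : ℝ) :
    ∃ K : ℝ, ∀ x y : X, dist x p ≤ R → R + 1 ≤ dist y p →
      gromovProd (quasihyperbolic X) p x y ≤ K := by
  obtain ⟨C, hC, hheight⟩ := hXA.exists_height_bound hA hd
  set m := min (distToBdry X p) C⁻¹ with hm
  have hm0 : 0 < m := lt_min (hd p) (inv_pos.2 hC)
  refine ⟨2 * (2 * A + 1) * Real.log (1 + A * (R + 1) / m) + 1 / 2, fun x y hx hy => ?_⟩
  obtain ⟨L, hL, γ, hγ, rfl, rfl, hlt⟩ := hXA.exists_integral_lt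
    (lt_add_one (quasihyperbolic X x y))
  have hcont := continuousOn_inv_distToBdry hd hγ.continuousOn
  have hii : ∀ u v, 0 ≤ u → u ≤ v → v ≤ L → IntervalIntegrable
      (fun t => (distToBdry X (γ t))⁻¹) MeasureTheory.volume u v := fun u v hu huv hv =>
    (hcont.mono (Icc_subset_Icc hu hv)).intervalIntegrable_of_Icc huv
  have hsplit : ∀ u, 0 ≤ u → u ≤ L → (∫ t in (0 : ℝ)..u, (distToBdry X (γ t))⁻¹) +
      ∫ t in u..L, (distToBdry X (γ t))⁻¹ = ∫ t in (0 : ℝ)..L, (distToBdry X (γ t))⁻¹ :=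
    fun u hu hv => intervalIntegral.integral_add_adjacent_intervals (hii 0 u le_rfl hu hv)
      (hii u L hu hv le_rfl)
  have hmin : ∀ u v, 0 ≤ u → u ≤ v → v ≤ L →
      ∫ t in u..v, (distToBdry X (γ t))⁻¹ ≤ quasihyperbolic X (γ u) (γ v) + 1 := by
    intro u v hu huv hv
    have h₁ := quasihyperbolic_le_integral_Icc hd hu
      (hγ.mono (Icc_subset_Icc_right (huv.trans hv)))
    have h₂ := quasihyperbolic_le_integral_Icc hd hv
      (hγ.mono (Icc_subset_Icc_left (hu.trans huv)))
    have h₃ := hXA.quasihyperbolic_triangle hd (γ 0) (γ u) (γ L)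
    have h₄ := hXA.quasihyperbolic_triangle hd (γ u) (γ v) (γ L)
    have h₅ := hsplit u hu (huv.trans hv)
    have h₆ := intervalIntegral.integral_add_adjacent_intervals (hii u v hu huv hv)
      (hii v L (hu.trans huv) hv le_rfl)
    linarith
  obtain ⟨T, hT, hfT, hTle⟩ := exists_first_hitting (f := fun t => dist (γ t) p) hL
    ((by fun_prop : Continuous fun z => dist z p).comp_continuousOn hγ.continuousOn)
    (by linarith) hy
  obtain ⟨τ, hτ, hdist⟩ := hheight T γ hT.1 (hγ.mono (Icc_subset_Icc_right hT.2))
    fun u v hu huv hv => hmin u v hu huv (hv.trans hT.2)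
  have hτL : τ ≤ L := hτ.2.trans hT.2
  have hτm : m ≤ distToBdry X (γ τ) := by
    refine (min_le_right _ _).trans ?_
    rw [inv_le_iff_one_le_mul₀' hC]
    linarith [dist_triangle (γ T) (γ 0) p, dist_comm (γ T) (γ 0)]
  have hk := hXA.quasihyperbolic_le_log hA hd hm0 hτm (min_le_left (distToBdry X p) C⁻¹)
  have hlog : Real.log (1 + A * dist (γ τ) p / m) ≤ Real.log (1 + A * (R + 1) / m) := by
    refine Real.log_le_log (by positivity) ?_
    gcongr
    exact hTle τ hτ
  have hlog' := mul_le_mul_of_nonneg_left hlog (by linarith : 0 ≤ 2 * (2 * A + 1))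
  have h₁ := quasihyperbolic_le_integral_Icc hd hτ.1 (hγ.mono (Icc_subset_Icc_right hτL))
  have h₂ := quasihyperbolic_le_integral_Icc_reverse hd hτL (hγ.mono (Icc_subset_Icc_left hτ.1))
  have h₃ := hXA.quasihyperbolic_triangle hd (γ 0) (γ τ) p
  have h₄ := hXA.quasihyperbolic_triangle hd (γ L) (γ τ) p
  have h₅ := hsplit τ hτ.1 hτL
  unfold gromovProd
  linarith

end Quasihyperbolic

/-- an unbounded Gromov sequence for the quasihyperbolic metric
of a uniform space converges to infinity in the original metric. -/
theorem unbounded_gromov_sequence_tendsto_infinity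
    {X : Type u} [MetricSpace X] (A : ℝ) (hA : 1 ≤ A)
    (hXA : IsUniformMS X A) (hd : ∀ x : X, 0 < distToBdry X x) (p : X)
    (x : ℕ → X)
    (hg : Tendsto (fun q : ℕ × ℕ =>
        gromovProd (quasihyperbolic X) p (x q.1) (x q.2)) atTop atTop)
    (hub : ¬ BddAbove (Set.range fun i : ℕ => dist (x i) p)) :
    ∀ q : X, Tendsto (fun i : ℕ => dist (x i) q) atTop atTop := by
  intro q
  refine tendsto_atTop.2 fun R => ?_
  obtain ⟨K, hK⟩ := hXA.exists_gromovProd_le hA hd p (R + dist q p)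
  obtain ⟨⟨N₁, N₂⟩, hN⟩ := eventually_atTop.1 (hg.eventually_gt_atTop K)
  obtain ⟨j, hj, hjR⟩ : ∃ j, N₂ ≤ j ∧ R + dist q p + 1 ≤ dist (x j) p := by
    by_contra! h
    refine hub (isBoundedUnder_of_eventually_le (f := atTop)
      (eventually_atTop.2 ⟨N₂, fun j hj => (h j hj).le⟩)).bddAbove_range
  filter_upwards [eventually_ge_atTop N₁] with i hi
  by_contra! h
  exact (hN (i, j) ⟨hi, hj⟩).not_ge
    (hK (x i) (x j) (by linarith [dist_triangle (x i) q p]) hjR)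

end
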